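/- Let n be even, let D be a probability distribution on Z_n (identified with {1,…,n}), let ε := d_TV(D, U) where U is the uniform distribution, and suppose ε ≤ 1/2. Let d₀ := D({1,…,n/2}), d₁ := D({n/2+1,…,n}), and p₀ := d₀² + d₁². Then 1/2 ≤ p₀ ≤ 1/2 + 2ε², and for every integer k ≥ 1 the distribution D̃ := (1−p₀)·D + p₀·D^{⊛k} satisfies d_TV(D̃, U) ≤ ε/2 + (1/2)(2ε)^k and d_TV(D̃, D) ≤ ε/2 + 2ε³ + (1/2)(2ε)^k. -/

import Mathlib

open Finset

/-- A probability distribution over a finite type. -/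
def IsDist {Ω : Type*} [Fintype Ω] (D : Ω → ℝ) : Prop :=
  (∀ x, 0 ≤ D x) ∧ ∑ x, D x = 1

/-- Total variation distance. -/
noncomputable def tv {Ω : Type*} [Fintype Ω] (D₁ D₂ : Ω → ℝ) : ℝ :=
  (1 / 2) * ∑ x, |D₁ x - D₂ x|

/-- Convolution of two distributions on a finite abelian group. -/
noncomputable def conv {G : Type*} [Fintype G] [AddCommGroup G] (D₁ D₂ : G → ℝ) (x : G) : ℝ :=
  ∑ g, D₁ (x - g) * D₂ g

/-- The uniform distribution on a finite type. -/
noncomputable def unif (G : Type*) [Fintype G] : G → ℝ := fun _ => 1 / (Fintype.card G : ℝ)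

/-- The `k`-fold convolution `D^{⊛k}` of `D` with itself (with `D^{⊛0}` the point mass at `0`,
so that `D^{⊛1} = D` as a distribution). -/
noncomputable def convIter {G : Type*} [Fintype G] [DecidableEq G] [AddCommGroup G]
    (D : G → ℝ) : ℕ → G → ℝ
  | 0 => fun x => if x = 0 then 1 else 0
  | k + 1 => conv (convIter D k) D

theorem sum_conv {G : Type*} [Fintype G] [AddCommGroup G] (F D : G → ℝ) :
    ∑ x, conv F D x = (∑ x, F x) * ∑ x, D x := by
  simp only [conv]
  rw [sum_comm, mul_sum]
  refine sum_congr rfl fun g _ => ?_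
  rw [← sum_mul]
  exact congrArg (· * D g) (Equiv.sum_comp (Equiv.subRight g) F)

theorem sum_convIter {G : Type*} [Fintype G] [DecidableEq G] [AddCommGroup G]
    {D : G → ℝ} (hD : ∑ x, D x = 1) (k : ℕ) : ∑ x, convIter D k x = 1 := by
  induction k with
  | zero => simp [convIter]
  | succ k ih => simp [convIter, sum_conv, ih, hD]

theorem convIter_one {G : Type*} [Fintype G] [DecidableEq G] [AddCommGroup G]
    (D : G → ℝ) : convIter D 1 = D := by
  funext x
  simp [convIter, conv, sub_eq_zero]

theorem sum_unif (G : Type*) [Fintype G] [Nonempty G] : ∑ x, unif G x = 1 := by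
  simp [unif]

/-- Subtracting the uniform distribution commutes with convolution of functions of total mass 1. -/
theorem conv_sub_unif {G : Type*} [Fintype G] [AddCommGroup G] {F D : G → ℝ}
    (hF : ∑ x, F x = 1) (hD : ∑ x, D x = 1) (x : G) :
    conv F D x - unif G x = conv (fun y => F y - unif G y) (fun y => D y - unif G y) x := by
  have hF' : ∑ g, F (x - g) = 1 := by rw [← hF]; exact Equiv.sum_comp (Equiv.subLeft x) F
  have hc : (Fintype.card G : ℝ) ≠ 0 := by
    have : 0 < Fintype.card G := Fintype.card_pos
    positivity
  simp only [conv, unif, sub_mul, mul_sub, sum_sub_distrib, ← mul_sum, ← sum_mul, hF', hD]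
  simp [hc]

theorem sum_abs_conv_le {G : Type*} [Fintype G] [AddCommGroup G] (F D : G → ℝ) :
    ∑ x, |conv F D x| ≤ (∑ x, |F x|) * ∑ x, |D x| := by
  rw [← sum_conv]
  refine sum_le_sum fun x _ => (abs_sum_le_sum_abs _ _).trans_eq ?_
  simp [conv, abs_mul]

theorem tv_convIter_unif_le {G : Type*} [Fintype G] [DecidableEq G] [AddCommGroup G]
    {D : G → ℝ} (hD : ∑ x, D x = 1) {k : ℕ} (hk : 1 ≤ k) :
    tv (convIter D k) (unif G) ≤ (1 / 2) * (2 * tv D (unif G)) ^ k := by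
  induction k, hk using Nat.le_induction with
  | base => rw [convIter_one]; linarith
  | succ k _ ih =>
    have h := sum_abs_conv_le (fun y => convIter D k y - unif G y) (fun y => D y - unif G y)
    simp only [← conv_sub_unif (sum_convIter hD k) hD] at h
    have h0 : 0 ≤ ∑ x, |D x - unif G x| := sum_nonneg fun _ _ => abs_nonneg _
    simp only [tv, convIter, pow_succ] at ih ⊢
    nlinarith [mul_le_mul_of_nonneg_right ih h0]

theorem tv_mix_le {Ω : Type*} [Fintype Ω] (P Q R : Ω → ℝ) {t : ℝ} (h0 : 0 ≤ t) (h1 : t ≤ 1) :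
    tv (fun x => (1 - t) * P x + t * Q x) R ≤ (1 - t) * tv P R + t * tv Q R := by
  have h : ∑ x, |(1 - t) * P x + t * Q x - R x| ≤
      (1 - t) * ∑ x, |P x - R x| + t * ∑ x, |Q x - R x| := by
    rw [mul_sum, mul_sum, ← sum_add_distrib]
    refine sum_le_sum fun x _ => ?_
    calc |(1 - t) * P x + t * Q x - R x| = |(1 - t) * (P x - R x) + t * (Q x - R x)| := by
          congr 1; ring
      _ ≤ |(1 - t) * (P x - R x)| + |t * (Q x - R x)| := abs_add_le _ _
      _ = _ := by rw [abs_mul, abs_mul, abs_of_nonneg h0, abs_of_nonneg (sub_nonneg.2 h1)]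
  simp only [tv]
  linarith

theorem tv_self {Ω : Type*} [Fintype Ω] (P : Ω → ℝ) : tv P P = 0 := by simp [tv]

theorem tv_comm {Ω : Type*} [Fintype Ω] (P Q : Ω → ℝ) : tv P Q = tv Q P := by
  simp only [tv, abs_sub_comm]

theorem tv_triangle {Ω : Type*} [Fintype Ω] (P Q R : Ω → ℝ) : tv P R ≤ tv P Q + tv Q R := by
  simp only [tv]
  rw [← mul_add, ← sum_add_distrib]
  gcongr
  exact abs_sub_le _ _ _

/-- The total variation distance bounds the difference of the probabilities of any event. -/
theorem abs_sum_filter_sub_le_tv {Ω : Type*} [Fintype Ω] {P Q : Ω → ℝ}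
    (h : ∑ x, P x = ∑ x, Q x) (p : Ω → Prop) [DecidablePred p] :
    |∑ x ∈ univ.filter p, P x - ∑ x ∈ univ.filter p, Q x| ≤ tv P Q := by
  have hP := sum_filter_add_sum_filter_not univ p P
  have hQ := sum_filter_add_sum_filter_not univ p Q
  have hA := sum_filter_add_sum_filter_not univ p (fun x => |P x - Q x|)
  have h1 := abs_sum_le_sum_abs (fun x => P x - Q x) (univ.filter p)
  have h2 := abs_sum_le_sum_abs (fun x => P x - Q x) (univ.filter fun x => ¬ p x)
  rw [sum_sub_distrib] at h1 h2
  have h3 : ∑ x ∈ univ.filter (fun x => ¬ p x), P x - ∑ x ∈ univ.filter (fun x => ¬ p x), Q x =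
      -(∑ x ∈ univ.filter p, P x - ∑ x ∈ univ.filter p, Q x) := by linarith
  rw [h3, abs_neg] at h2
  simp only [tv]
  linarith

theorem ZMod.card_filter_val_mem_Icc {n : ℕ} [NeZero n] {m : ℕ} (hm : m < n) :
    (univ.filter fun x : ZMod n => 1 ≤ x.val ∧ x.val ≤ m).card = m := by
  conv_rhs => rw [← Nat.add_sub_cancel m 1, ← Nat.card_Icc 1 m]
  refine card_nbij' ZMod.val (fun i => (i : ZMod n)) ?_ ?_ ?_ ?_
  · intro x hx; simpa using hx
  · intro i hi
    have hi' := mem_Icc.1 (mem_coe.1 hi)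
    simp [ZMod.val_natCast_of_lt (hi'.2.trans_lt hm), hi'.1, hi'.2]
  · intro x _; simp
  · intro i hi
    exact ZMod.val_natCast_of_lt ((mem_Icc.1 (mem_coe.1 hi)).2.trans_lt hm)

/-- Let `n` be even, `D` a probability distribution on `Z_n` (identified with `{1,…,n}`,
an element `x ∈ Z_n` representing `x.val` for `1 ≤ x.val ≤ n/2` etc., `0` representing `n`),
and `ε := d_TV(D, U) ≤ 1/2`.  Let `d₀ := D({1,…,n/2})`, `d₁ := D({n/2+1,…,n})`, and
`p₀ := d₀² + d₁²`.  Then `1/2 ≤ p₀ ≤ 1/2 + 2ε²`, and for every `k ≥ 1` the mixture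
`D̃ := (1−p₀)·D + p₀·D^{⊛k}` satisfies `d_TV(D̃, U) ≤ ε/2 + (1/2)(2ε)^k` and
`d_TV(D̃, D) ≤ ε/2 + 2ε³ + (1/2)(2ε)^k`. -/
theorem stmt_9 (n : ℕ) [NeZero n] (hn : Even n)
    (D : ZMod n → ℝ) (hD : IsDist D)
    (ε : ℝ) (hε : ε = tv D (unif (ZMod n))) (hε2 : ε ≤ 1 / 2)
    (d₀ d₁ p₀ : ℝ)
    (hd₀ : d₀ = ∑ x ∈ univ.filter (fun x : ZMod n => 1 ≤ x.val ∧ x.val ≤ n / 2), D x)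
    (hd₁ : d₁ = ∑ x ∈ univ.filter (fun x : ZMod n => ¬(1 ≤ x.val ∧ x.val ≤ n / 2)), D x)
    (hp₀ : p₀ = d₀ ^ 2 + d₁ ^ 2)
    (k : ℕ) (hk : 1 ≤ k) :
    1 / 2 ≤ p₀ ∧ p₀ ≤ 1 / 2 + 2 * ε ^ 2 ∧
      tv (fun x => (1 - p₀) * D x + p₀ * convIter D k x) (unif (ZMod n)) ≤
        ε / 2 + (1 / 2) * (2 * ε) ^ k ∧
      tv (fun x => (1 - p₀) * D x + p₀ * convIter D k x) D ≤
        ε / 2 + 2 * ε ^ 3 + (1 / 2) * (2 * ε) ^ k := by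
  have hn0 : n ≠ 0 := NeZero.ne n
  have hU : ∑ x ∈ univ.filter (fun x : ZMod n => 1 ≤ x.val ∧ x.val ≤ n / 2), unif (ZMod n) x
      = 1 / 2 := by
    obtain ⟨m, hm⟩ := hn
    simp only [unif, sum_const, ZMod.card, nsmul_eq_mul]
    rw [ZMod.card_filter_val_mem_Icc (by lia), show n / 2 = m by lia, hm]
    have : (m : ℝ) ≠ 0 := by
      have : m ≠ 0 := by lia
      exact_mod_cast this
    push_cast
    field_simp
    norm_num
  have hd : |d₀ - 1 / 2| ≤ ε := by
    rw [hε, hd₀, ← hU]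
    exact abs_sum_filter_sub_le_tv (hD.2.trans (sum_unif _).symm) _
  have hsum : d₀ + d₁ = 1 := by
    rw [hd₀, hd₁, sum_filter_add_sum_filter_not, hD.2]
  have hp : p₀ = 1 / 2 + 2 * (d₀ - 1 / 2) ^ 2 := by
    rw [hp₀, eq_sub_of_add_eq' hsum]; ring
  have hε0 : 0 ≤ ε := (abs_nonneg _).trans hd
  have hlo : 1 / 2 ≤ p₀ := by rw [hp]; nlinarith [sq_nonneg (d₀ - 1 / 2)]
  have hhi : p₀ ≤ 1 / 2 + 2 * ε ^ 2 := by
    rw [hp]; linarith [sq_le_sq' (abs_le.1 hd).1 (abs_le.1 hd).2]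
  have hp1 : p₀ ≤ 1 := by nlinarith
  have hconv := tv_convIter_unif_le hD.2 hk
  rw [← hε] at hconv
  have hpow : 0 ≤ (1 / 2) * (2 * ε) ^ k := by positivity
  refine ⟨hlo, hhi, ?_, ?_⟩
  · have h := tv_mix_le D (convIter D k) (unif (ZMod n)) (by linarith) hp1
    rw [← hε] at h
    nlinarith
  · have h := tv_mix_le D (convIter D k) D (by linarith) hp1
    have h' := tv_triangle (convIter D k) (unif (ZMod n)) D
    rw [tv_comm (unif (ZMod n)) D, ← hε] at h'
    rw [tv_self, mul_zero, zero_add] at h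
    have h2 := mul_le_mul_of_nonneg_left (h'.trans (add_le_add_left hconv ε)) (by linarith : 0 ≤ p₀)
    have h3 := mul_le_mul_of_nonneg_right hp1 hpow
    have h4 := mul_le_mul_of_nonneg_right hhi hε0
    nlinarith
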